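/- arXiv:2008.04273 — 2 statements merged into one kernel-verified Lean document; each statement's English description precedes it below -/
import Mathlib

section
/- Fix d ≥ 1. For every w ∈ ℂ with |w| < 1 and all x, y ∈ ℝ^d, the series Σ_{α ∈ ℕ^d} w^{|α|} φ_α(x) φ_α(y) converges absolutely, and its sum equals π^{−d/2} (1−w²)^{−d/2} exp( 2w (x·y)/(1−w²) − (1+w²)(|x|²+|y|²)/(2(1−w²)) ), where (1−w²)^{−d/2} := exp(−(d/2) Log(1−w²)) with Log the principal logarithm (well defined since Re(1−w²) > 0 when |w| < 1). This is the Mehler formula for the propagator of the isotropic harmonic oscillator at ħ = 1, with w = e^{−it}, Im t < 0. -/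
open MeasureTheory Real Filter
open scoped BigOperators ENNReal

noncomputable section

/-- Physicists' Hermite polynomials `H_n`, defined by `H_0 = 1`,
`H_{n+1}(t) = 2 t H_n(t) - H_n'(t)`. -/
def physHermite : ℕ → Polynomial ℝ
  | 0 => 1
  | n + 1 => 2 * Polynomial.X * physHermite n - Polynomial.derivative (physHermite n)

/-- The `L²`-normalized Hermite function `φ_n(t) = (2^n n! √π)^{-1/2} H_n(t) e^{-t²/2}`. -/
def hermiteFun (n : ℕ) (t : ℝ) : ℝ :=
  ((2 : ℝ) ^ n * (n.factorial : ℝ) * Real.sqrt π) ^ (-(1 : ℝ) / 2) *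
    (physHermite n).eval t * Real.exp (-t ^ 2 / 2)

/-- The product Hermite function `φ_α(x) = ∏_j φ_{α_j}(x_j)` on `ℝ^d`. -/
def hermiteProd {d : ℕ} (α : Fin d → ℕ) (x : Fin d → ℝ) : ℝ :=
  ∏ j, hermiteFun (α j) (x j)

/-- Euclidean dot product on `ℝ^d`. -/
def dotR {d : ℕ} (v ξ : Fin d → ℝ) : ℝ := ∑ j, v j * ξ j

theorem physHermite_deriv (n : ℕ) :
    Polynomial.derivative (physHermite (n+1)) = 2 * ((n:Polynomial ℝ)+1) * physHermite n := by
  induction n with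
  | zero => simp [physHermite]
  | succ n ih =>
    rw [physHermite, ih]
    simp only [Polynomial.derivative_sub, Polynomial.derivative_mul, ih]
    rw [physHermite]
    simp
    ring

theorem physHermite_rec (n : ℕ) (x : ℝ) : (physHermite (n+2)).eval x =
    2 * x * (physHermite (n+1)).eval x - 2 * (n+1) * (physHermite n).eval x := by
  rw [physHermite, physHermite_deriv]
  simp

/-- coefficients -/
def mc (x y : ℝ) (n : ℕ) : ℝ :=
  (physHermite n).eval x * (physHermite n).eval y / (2 ^ n * (n.factorial : ℝ))

theorem mc_zero (x y : ℝ) : mc x y 0 = 1 := by simp [mc, physHermite]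
theorem mc_one (x y : ℝ) : mc x y 1 = 2 * x * y := by simp [mc, physHermite]; ring
theorem mc_two (x y : ℝ) : mc x y 2 = (4*x^2-2)*(4*y^2-2)/8 := by
  simp only [mc]
  rw [physHermite_rec, physHermite_rec]
  simp [physHermite, Nat.factorial]; ring
theorem mc_three (x y : ℝ) : mc x y 3 = (8*x^3-12*x)*(8*y^3-12*y)/48 := by
  simp only [mc]
  rw [physHermite_rec, physHermite_rec, physHermite_rec, physHermite_rec]
  simp [physHermite, Nat.factorial]; ring
theorem mc_rec (x y : ℝ) (n : ℕ) :
    ((n:ℝ)+4) * mc x y (n+4) - 2 * ((n:ℝ)+2) * mc x y (n+2) + n * mc x y n =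
    mc x y (n+2) - mc x y n + 2*x*y*(mc x y (n+3) + mc x y (n+1)) - 2*(x^2+y^2) * mc x y (n+2) := by
  simp only [mc]
  rw [physHermite_rec (n+2), physHermite_rec (n+2), physHermite_rec (n+1), physHermite_rec (n+1), physHermite_rec n,
    physHermite_rec n]
  generalize (physHermite (n+1)).eval x = a1
  generalize (physHermite (n+1)).eval y = b1
  generalize (physHermite n).eval x = a
  generalize (physHermite n).eval y = b
  have hf : (n.factorial : ℝ) ≠ 0 := by positivity
  have h1 : (n:ℝ)+1 ≠ 0 := by positivity
  have h2 : (n:ℝ)+2 ≠ 0 := by positivity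
  have h3 : (n:ℝ)+3 ≠ 0 := by positivity
  have h4 : (n:ℝ)+4 ≠ 0 := by positivity
  have e1 : ((n+1).factorial : ℝ) = (n+1) * n.factorial := by push_cast [Nat.factorial_succ]; ring
  have e2 : ((n+2).factorial : ℝ) = (n+2) * ((n+1) * n.factorial) := by push_cast [Nat.factorial_succ]; ring
  have e3 : ((n+3).factorial : ℝ) = (n+3) * ((n+2) * ((n+1) * n.factorial)) := by push_cast [Nat.factorial_succ]; ring
  have e4 : ((n+4).factorial : ℝ) = (n+4) * ((n+3) * ((n+2) * ((n+1) * n.factorial))) := by push_cast [Nat.factorial_succ]; ring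
  rw [e1, e2, e3, e4]
  push_cast
  simp only [pow_add]
  field_simp
  ring

/-- shift -/
def shf (a : ℕ → ℂ) : ℕ → ℂ
  | 0 => 0
  | n + 1 => a n

/-- power series expansion on the unit disk -/
def PS (a : ℕ → ℂ) (f : ℂ → ℂ) : Prop :=
  ∀ z : ℂ, ‖z‖ < 1 → HasSum (fun n => a n * z ^ n) (f z)

theorem PS.add {a b f g} (h : PS a f) (k : PS b g) : PS (fun n => a n + b n) (fun z => f z + g z) := by
  intro z hz
  simpa only [add_mul] using (h z hz).add (k z hz)

theorem PS.sub {a b f g} (h : PS a f) (k : PS b g) : PS (fun n => a n - b n) (fun z => f z - g z) := by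
  intro z hz
  simpa only [sub_mul] using (h z hz).sub (k z hz)

theorem PS.smul {a f} (c : ℂ) (h : PS a f) : PS (fun n => c * a n) (fun z => c * f z) := by
  intro z hz
  simpa only [mul_assoc] using (h z hz).mul_left c

theorem PS.shf {a f} (h : PS a f) : PS (shf a) (fun z => z * f z) := by
  intro z hz
  have := (h z hz).mul_left z
  rw [← hasSum_nat_add_iff' 1]
  simp only [_root_.shf, Finset.sum_range_one, zero_mul, sub_zero]
  refine this.congr_fun ?_
  intro n
  ring

theorem PS.congr_val {a f g} (h : PS a f) (e : ∀ z : ℂ, ‖z‖ < 1 → f z = g z) : PS a g := by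
  intro z hz
  rw [← e z hz]
  exact h z hz

theorem PS.zero {a} (h : PS a (fun _ => 0)) (n : ℕ) : a n = 0 := by
  have : HasFPowerSeriesAt (fun _ : ℂ => (0:ℂ)) (FormalMultilinearSeries.ofScalars ℂ a) 0 := by
    rw [hasFPowerSeriesAt_iff]
    filter_upwards [Metric.ball_mem_nhds (0:ℂ) one_pos] with z hz
    have := h z (by simpa using hz)
    simpa [FormalMultilinearSeries.coeff_ofScalars, mul_comm] using this
  have h2 := this.eq_zero
  have := congrArg (fun p => p.coeff n) h2
  simp only [FormalMultilinearSeries.coeff_ofScalars] at this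
  rw [this]
  simp [FormalMultilinearSeries.coeff]

theorem PS.taylor {f : ℂ → ℂ} (hf : DifferentiableOn ℂ f (Metric.ball 0 1)) :
    ∃ a : ℕ → ℂ, a 0 = f 0 ∧ PS a f ∧ PS (fun n => ((n:ℂ)+1) * a (n+1)) (deriv f) := by
  refine ⟨fun n => ((n.factorial : ℂ))⁻¹ * iteratedDeriv n f 0, by simp, ?_, ?_⟩
  · intro z hz
    have := Complex.hasSum_taylorSeries_on_ball hf (z := z) (by simpa using hz)
    refine this.congr_fun ?_
    intro n
    simp; ring
  · intro z hz
    have := Complex.hasSum_taylorSeries_on_ball (hf.deriv Metric.isOpen_ball) (z := z) (by simpa using hz)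
    refine this.congr_fun ?_
    intro n
    beta_reduce
    rw [iteratedDeriv_succ', Nat.factorial_succ]
    have : (n:ℂ)+1 ≠ 0 := by exact_mod_cast Nat.succ_ne_zero n
    simp
    field_simp

/-- generating function -/
def mG (x y : ℝ) (z : ℂ) : ℂ :=
  Complex.exp (-(1/2) * Complex.log (1 - z^2) + (2*x*y*z - (x^2+y^2)*z^2)/(1-z^2))

theorem slit {z : ℂ} (hz : ‖z‖ < 1) : 1 - z^2 ∈ Complex.slitPlane := by
  have : ‖-z^2‖ < 1 := by rw [norm_neg, norm_pow]; exact pow_lt_one₀ (norm_nonneg _) hz two_ne_zero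
  simpa [sub_eq_add_neg] using Complex.mem_slitPlane_of_norm_lt_one this

theorem mG_deriv (x y : ℝ) {z : ℂ} (hz : ‖z‖ < 1) : HasDerivAt (mG x y)
    (mG x y z * (z/(1-z^2) + (2*x*y*(1+z^2) - 2*(x^2+y^2)*z)/(1-z^2)^2)) z := by
  have hs := slit hz
  have h0 : 1 - z^2 ≠ 0 := Complex.slitPlane_ne_zero hs
  have h1 : HasDerivAt (fun z : ℂ => 1 - z^2) (-(2*z)) z := by
    simpa using ((hasDerivAt_id z).pow 2).const_sub 1
  have h2 : HasDerivAt (fun z : ℂ => 2*x*y*z - (x^2+y^2)*z^2) (2*x*y - (x^2+y^2)*(2*z)) z := by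
    have e1 := (hasDerivAt_id z).const_mul (2*x*y : ℂ)
    have e2 := ((hasDerivAt_id z).pow 2).const_mul ((x:ℂ)^2+y^2 : ℂ)
    refine (e1.sub e2).congr_deriv ?_
    simp
  have := (((h1.clog hs).const_mul (-(1/2) : ℂ)).add (h2.div h1 h0)).cexp
  refine this.congr_deriv ?_
  simp only [mG, Pi.add_apply, Pi.div_apply]
  congr 1
  field_simp
  ring

theorem mG_ps (x y : ℝ) : PS (fun n => (mc x y n : ℂ)) (mG x y) := by
  have hd : DifferentiableOn ℂ (mG x y) (Metric.ball 0 1) := fun z hz =>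
    (mG_deriv x y (by simpa using hz)).differentiableAt.differentiableWithinAt
  obtain ⟨a, a0, h, h'⟩ := PS.taylor hd
  have key := (((h'.sub (h'.shf.shf.smul 2)).add h'.shf.shf.shf.shf).sub
    (((h.shf.sub h.shf.shf.shf).add ((h.add h.shf.shf).smul (2*x*y))).sub (h.shf.smul (2*(x^2+y^2)))))
  have hz := key.congr_val (g := fun _ => 0) (by
    intro z hz
    have h0 : 1 - z^2 ≠ 0 := Complex.slitPlane_ne_zero (slit hz)
    beta_reduce
    rw [(mG_deriv x y hz).deriv]
    field_simp
    ring)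
  have hr := hz.zero
  have c0 : a 0 = mc x y 0 := by rw [a0, mc_zero]; simp [mG]
  have c1 : a 1 = mc x y 1 := by
    have := hr 0
    simp [shf] at this
    rw [mc_one]; push_cast
    rw [mc_zero] at c0; push_cast at c0
    linear_combination this + 2*x*y*c0
  have c2 : a 2 = mc x y 2 := by
    have := hr 1
    simp [shf] at this
    rw [mc_two]; push_cast
    rw [mc_zero] at c0; push_cast at c0
    rw [mc_one] at c1; push_cast at c1
    rw [c0, c1] at this
    linear_combination this / 2
  have c3 : a 3 = mc x y 3 := by
    have := hr 2
    simp [shf] at this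
    rw [mc_three]; push_cast
    rw [mc_zero] at c0; push_cast at c0
    rw [mc_one] at c1; push_cast at c1
    rw [mc_two] at c2; push_cast at c2
    rw [c0, c1, c2] at this
    linear_combination this / 3
  have all : ∀ n, a n = mc x y n ∧ a (n+1) = mc x y (n+1) ∧ a (n+2) = mc x y (n+2) ∧
      a (n+3) = mc x y (n+3) := by
    intro n
    induction n with
    | zero => exact ⟨c0, c1, c2, c3⟩
    | succ n ih =>
      obtain ⟨i0, i1, i2, i3⟩ := ih
      refine ⟨i1, i2, i3, ?_⟩
      have r := congrArg (fun t : ℝ => (t : ℂ)) (mc_rec x y n)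
      have q := hr (n+3)
      have h4 : (n:ℂ) + 4 ≠ 0 := by exact_mod_cast Nat.succ_ne_zero (n+3)
      have hs : shf (shf (shf (shf fun n => ((n:ℂ) + 1) * a (n + 1)))) (n+3) = n * a n := by
        cases n <;> simp [shf]
      rw [hs] at q
      simp only [shf] at q
      push_cast at r q
      rw [i0, i1, i2, i3] at q
      apply mul_left_cancel₀ h4
      show _ * a (n+3+1) = _ * (mc x y (n+4) : ℂ)
      linear_combination q - r
  have : a = fun n => (mc x y n : ℂ) := funext fun n => (all n).1
  rwa [← this]

theorem ps_norm {a f} (h : PS a f) {w : ℂ} (hw : ‖w‖ < 1) : Summable fun n => ‖a n * w ^ n‖ :=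
  (h w hw).summable.norm

theorem term_eq (w : ℂ) (x y : ℝ) (n : ℕ) :
    w ^ n * ((hermiteFun n x * hermiteFun n y : ℝ) : ℂ) =
    ((π ^ (-(1:ℝ) / 2) * Real.exp (-(x^2+y^2)/2) : ℝ) : ℂ) * ((mc x y n : ℂ) * w ^ n) := by
  have hK : (0:ℝ) < 2 ^ n * (n.factorial : ℝ) := by positivity
  have e : hermiteFun n x * hermiteFun n y =
      π ^ (-(1:ℝ) / 2) * Real.exp (-(x^2+y^2)/2) * mc x y n := by
    have h1 : Real.exp (-(x^2+y^2)/2) = Real.exp (-x^2/2) * Real.exp (-y^2/2) := by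
      rw [← Real.exp_add]; congr 1; ring
    have h2 : (((2 : ℝ) ^ n * (n.factorial : ℝ) * Real.sqrt π) ^ (-(1 : ℝ) / 2)) *
        (((2 : ℝ) ^ n * (n.factorial : ℝ) * Real.sqrt π) ^ (-(1 : ℝ) / 2)) =
        π ^ (-(1:ℝ) / 2) / (2 ^ n * (n.factorial : ℝ)) := by
      rw [← Real.rpow_add (by positivity)]
      rw [show -(1:ℝ)/2 + -(1:ℝ)/2 = -1 by norm_num, Real.rpow_neg_one,
        neg_div, Real.rpow_neg pi_pos.le, Real.sqrt_eq_rpow]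
      field_simp
    simp only [hermiteFun, mc]
    rw [h1]
    linear_combination (Polynomial.eval x (physHermite n) * Polynomial.eval y (physHermite n) *
      Real.exp (-x^2/2) * Real.exp (-y^2/2)) * h2
  rw [e]
  push_cast
  ring

theorem prod_sum (d : ℕ) (f : Fin d → ℕ → ℂ) (s : Fin d → ℂ) (hn : ∀ j, Summable fun n => ‖f j n‖)
    (hs : ∀ j, HasSum (f j) (s j)) :
    (Summable fun α : Fin d → ℕ => ‖∏ j, f j (α j)‖) ∧
    HasSum (fun α : Fin d → ℕ => ∏ j, f j (α j)) (∏ j, s j) := by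
  induction d with
  | zero =>
    refine ⟨(hasSum_fintype _).summable, ?_⟩
    convert hasSum_fintype (fun α : Fin 0 → ℕ => ∏ j, f j (α j)) using 1
    simp
  | succ d ih =>
    obtain ⟨i1, i2⟩ := ih (fun j => f j.succ) (fun j => s j.succ) (fun j => hn _) (fun j => hs _)
    have m1 := (hn 0).mul_norm i1
    have m2 := (hs 0).mul i2 m1.of_norm
    constructor
    · rw [← (Fin.consEquiv (fun _ => ℕ)).summable_iff]
      refine m1.congr ?_
      intro p
      simp [Fin.prod_univ_succ, Fin.consEquiv]
    · rw [← (Fin.consEquiv (fun _ => ℕ)).hasSum_iff, Fin.prod_univ_succ]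
      refine m2.congr_fun ?_
      intro p
      simp [Fin.prod_univ_succ, Fin.consEquiv]

/-- **Mehler's formula.** For `|w| < 1`, the series `Σ_α w^{|α|} φ_α(x) φ_α(y)` converges
absolutely, with sum `π^{-d/2} (1-w²)^{-d/2} exp(2w x·y/(1-w²) - (1+w²)(|x|²+|y|²)/(2(1-w²)))`,
where `(1-w²)^{-d/2} = exp(-(d/2) Log(1-w²))` with `Log` the principal branch. -/
theorem mehler_formula (d : ℕ) (hd : 1 ≤ d) (w : ℂ) (hw : ‖w‖ < 1)
    (x y : Fin d → ℝ) :
    Summable (fun α : Fin d → ℕ =>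
      ‖w ^ (∑ j, α j) * ((hermiteProd α x * hermiteProd α y : ℝ) : ℂ)‖) ∧
    ∑' α : Fin d → ℕ, w ^ (∑ j, α j) * ((hermiteProd α x * hermiteProd α y : ℝ) : ℂ) =
      ((π ^ (-(d : ℝ) / 2) : ℝ) : ℂ) *
        Complex.exp (-((d : ℂ) / 2) * Complex.log (1 - w ^ 2)) *
        Complex.exp (2 * w * (dotR x y : ℂ) / (1 - w ^ 2) -
          (1 + w ^ 2) * (((∑ j, x j ^ 2) + ∑ j, y j ^ 2 : ℝ) : ℂ) / (2 * (1 - w ^ 2))) := by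
  have hn : ∀ j, Summable fun n => ‖w ^ n * ((hermiteFun n (x j) * hermiteFun n (y j) : ℝ) : ℂ)‖ := by
    intro j
    simp only [term_eq]
    exact ((mG_ps (x j) (y j) w hw).mul_left _).summable.norm
  have hs : ∀ j, HasSum (fun n => w ^ n * ((hermiteFun n (x j) * hermiteFun n (y j) : ℝ) : ℂ))
      (((π ^ (-(1:ℝ) / 2) * Real.exp (-((x j)^2+(y j)^2)/2) : ℝ) : ℂ) * mG (x j) (y j) w) := by
    intro j
    simp only [term_eq]
    exact (mG_ps (x j) (y j) w hw).mul_left _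
  have ht : ∀ α : Fin d → ℕ, w ^ (∑ j, α j) * ((hermiteProd α x * hermiteProd α y : ℝ) : ℂ) =
      ∏ j, (w ^ (α j) * ((hermiteFun (α j) (x j) * hermiteFun (α j) (y j) : ℝ) : ℂ)) := by
    intro α
    simp only [hermiteProd, Finset.prod_mul_distrib, Finset.prod_pow_eq_pow_sum]
    push_cast
    simp only [Finset.prod_mul_distrib]
  obtain ⟨p1, p2⟩ := prod_sum d _ _ hn hs
  simp only [ht]
  refine ⟨p1, p2.tsum_eq.trans ?_⟩
  have h0 : 1 - w^2 ≠ 0 := Complex.slitPlane_ne_zero (slit hw)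
  have hpi : (∏ _j : Fin d, ((π ^ (-(1:ℝ) / 2) : ℝ) : ℂ)) = ((π ^ (-(d : ℝ) / 2) : ℝ) : ℂ) := by
    rw [Finset.prod_const, ← Complex.ofReal_pow, ← Real.rpow_natCast, ← Real.rpow_mul pi_pos.le]
    congr 2
    simp
    ring
  have hj : ∀ j, ((π ^ (-(1:ℝ) / 2) * Real.exp (-((x j)^2+(y j)^2)/2) : ℝ) : ℂ) * mG (x j) (y j) w =
      ((π ^ (-(1:ℝ) / 2) : ℝ) : ℂ) * Complex.exp (-(1/2) * Complex.log (1 - w ^ 2) +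
        (2 * w / (1 - w^2) * ((x j : ℂ) * y j) -
          (1 + w^2) / (2 * (1 - w^2)) * ((x j : ℂ)^2 + (y j : ℂ)^2))) := by
    intro j
    rw [Complex.ofReal_mul, mul_assoc, Complex.ofReal_exp, mG, ← Complex.exp_add]
    congr 2
    push_cast
    field_simp
    ring
  rw [Finset.prod_congr rfl (fun j _ => hj j), Finset.prod_mul_distrib, hpi, ← Complex.exp_sum,
    mul_assoc, ← Complex.exp_add]
  congr 2
  simp only [Finset.sum_add_distrib, Finset.sum_sub_distrib, ← Finset.mul_sum, dotR]
  push_cast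
  simp
  ring
end
end

section
/- For all d ≥ 1, N ∈ ℕ, ħ > 0 and (x,ξ) ∈ ℝ^d × ℝ^d, the Wigner distribution of the N-th eigenspace projection of the isotropic harmonic oscillator satisfies W_{ħ,N}(x,ξ) = ((−1)^N/(πħ)^d) e^{−2H(x,ξ)/ħ} L_N^{(d−1)}(4H(x,ξ)/ħ), where H(x,ξ) = (|x|² + |ξ|²)/2. -/
open MeasureTheory Real Filter
open scoped BigOperators ENNReal

noncomputable section

/-- The rescaled Hermite eigenfunction `φ_{α,hb}(x) = hb^{-d/4} φ_α(hb^{-1/2} x)`. -/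
def hermiteProdH {d : ℕ} (hb : ℝ) (α : Fin d → ℕ) (x : Fin d → ℝ) : ℝ :=
  hb ^ (-(d : ℝ) / 4) * hermiteProd α fun j => hb ^ (-(1 : ℝ) / 2) * x j

/-- The eigenspace projection kernel `Π_{hb,N}(x,y) = Σ_{|α|=N} φ_{α,hb}(x) φ_{α,hb}(y)`. -/
def projKer (d : ℕ) (hb : ℝ) (N : ℕ) (x y : Fin d → ℝ) : ℝ :=
  ∑ α ∈ Finset.Nat.antidiagonalTuple d N, hermiteProdH hb α x * hermiteProdH hb α y

/-- The Wigner distribution of the `N`-th eigenspace projection,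
`W_{hb,N}(x,ξ) = (2πhb)^{-d} ∫ Π_{hb,N}(x+v/2, x-v/2) e^{-i v·ξ/hb} dv`. -/
def wigner (d : ℕ) (hb : ℝ) (N : ℕ) (x ξ : Fin d → ℝ) : ℂ :=
  ((((2 * π * hb) ^ d)⁻¹ : ℝ) : ℂ) *
    ∫ v : Fin d → ℝ,
      ((projKer d hb N (fun j => x j + v j / 2) (fun j => x j - v j / 2) : ℝ) : ℂ) *
        Complex.exp (-Complex.I * (dotR v ξ : ℂ) / (hb : ℂ))

/-- The classical Hamiltonian `H(x,ξ) = (|x|² + |ξ|²)/2`. -/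
def Hfun {d : ℕ} (x ξ : Fin d → ℝ) : ℝ := ((∑ j, x j ^ 2) + ∑ j, ξ j ^ 2) / 2

/-- `hb_N(E) = E/(N + d/2)`, so that `E_N(hb) = hb(N + d/2) = E`. -/
def hPl (d : ℕ) (E : ℝ) (N : ℕ) : ℝ := E / ((N : ℝ) + (d : ℝ) / 2)

/-- The Airy function `Ai(s) = (1/π) lim_{T→∞} ∫_0^T cos(t³/3 + s t) dt`. -/
def airy (s : ℝ) : ℝ :=
  (1 / π) * limUnder Filter.atTop fun T : ℝ => ∫ t in (0 : ℝ)..T, Real.cos (t ^ 3 / 3 + s * t)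

/-- Associated Laguerre polynomial `L_N^{(a)}(x) = Σ_{j=0}^N (-1)^j C(N+a, N-j) x^j/j!`. -/
def assocLaguerre (N a : ℕ) (x : ℝ) : ℝ :=
  ∑ j ∈ Finset.range (N + 1),
    (-1 : ℝ) ^ j * ((N + a).choose (N - j) : ℝ) * x ^ j / (j.factorial : ℝ)

open Polynomial in
/-- Gaussian integral functional. -/
def gJ (ξ : ℝ) (p : ℂ[X]) : ℂ :=
  ∫ v : ℝ, p.eval (v : ℂ) * Complex.exp (-(1/4) * (v : ℂ) ^ 2 + (-Complex.I * ξ) * v + 0)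

open Polynomial in
lemma gJ_integrable (ξ : ℝ) (p : ℂ[X]) :
    Integrable fun v : ℝ => p.eval (v : ℂ) *
      Complex.exp (-(1/4) * (v : ℂ) ^ 2 + (-Complex.I * ξ) * v + 0) := by
  induction p using Polynomial.induction_on' with
  | add p q hp hq =>
    simp only [Polynomial.eval_add, add_mul]
    exact hp.add hq
  | monomial n a =>
    have h := integrable_rpow_mul_exp_neg_mul_sq (b := 1/4) (by norm_num)
      (s := (n : ℝ)) (by have := Nat.cast_nonneg (α := ℝ) n; linarith)
    simp only [Real.rpow_natCast] at h
    simp only [Polynomial.eval_monomial, mul_assoc]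
    refine Integrable.const_mul ?_ a
    refine (h.norm).mono' (by fun_prop) (ae_of_all _ fun v => ?_)
    rw [norm_mul, norm_mul, Complex.norm_exp, norm_pow, norm_pow, Complex.norm_real,
      Real.norm_eq_abs (Real.exp _), Real.abs_exp]
    apply le_of_eq
    congr 2
    simp [← Complex.ofReal_pow]

open Polynomial in
lemma gJ_add (ξ : ℝ) (p q : ℂ[X]) : gJ ξ (p + q) = gJ ξ p + gJ ξ q := by
  unfold gJ
  rw [← integral_add (gJ_integrable ξ p) (gJ_integrable ξ q)]
  simp only [Polynomial.eval_add, add_mul]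

open Polynomial in
lemma gJ_smul (ξ : ℝ) (a : ℂ) (p : ℂ[X]) : gJ ξ (C a * p) = a * gJ ξ p := by
  unfold gJ
  rw [← integral_const_mul]
  simp only [Polynomial.eval_mul, Polynomial.eval_C, mul_assoc]

open Polynomial in
lemma gJ_ibp (ξ : ℝ) (p : ℂ[X]) :
    gJ ξ (derivative p - (C (1/2) * X + C (Complex.I * ξ)) * p) = 0 := by
  unfold gJ
  refine integral_eq_zero_of_hasDerivAt_of_integrable (f := fun v : ℝ => p.eval (v : ℂ) *
      Complex.exp (-(1/4) * (v : ℂ) ^ 2 + (-Complex.I * ξ) * v + 0)) ?_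
      (gJ_integrable ξ _) (gJ_integrable ξ p)
  intro v
  have h1 : HasDerivAt (fun z : ℂ => p.eval z *
      Complex.exp (-(1/4) * z ^ 2 + (-Complex.I * ξ) * z + 0))
      ((derivative p - (C (1/2) * X + C (Complex.I * ξ)) * p).eval (v : ℂ) *
        Complex.exp (-(1/4) * (v : ℂ) ^ 2 + (-Complex.I * ξ) * v + 0)) (v : ℂ) := by
    have h2 : HasDerivAt (fun z : ℂ => -(1/4) * z ^ 2 + (-Complex.I * ξ) * z + 0)
        (-(1/4) * (2 * (v : ℂ)) + (-Complex.I * ξ)) (v : ℂ) := by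
      have := ((((hasDerivAt_id (v : ℂ)).pow 2).const_mul (-(1/4) : ℂ)).add
        ((hasDerivAt_id (v : ℂ)).const_mul (-Complex.I * ξ))).add_const 0
      convert! this using 1
      simp
    convert! (p.hasDerivAt (v : ℂ)).mul h2.cexp using 1
    simp
    ring
  exact h1.comp_ofReal

lemma gJ_one (ξ : ℝ) : gJ ξ 1 = 2 * (Real.sqrt π * Real.exp (-ξ ^ 2) : ℝ) := by
  unfold gJ
  simp only [Polynomial.eval_one, one_mul]
  rw [integral_cexp_quadratic (by norm_num)]
  have h1 : ((π : ℂ) / -(-(1/4))) ^ (1 / 2 : ℂ) = ((2 * Real.sqrt π : ℝ) : ℂ) := by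
    have : ((π : ℂ) / -(-(1/4))) = ((4 * π : ℝ) : ℂ) := by push_cast; ring
    rw [this, show (1/2 : ℂ) = ((1/2 : ℝ) : ℂ) by push_cast; rfl,
      ← Complex.ofReal_cpow (by positivity), ← Real.sqrt_eq_rpow, Real.sqrt_mul (by norm_num)]
    congr 2
    rw [show (4:ℝ) = 2 ^ 2 by norm_num, Real.sqrt_sq (by norm_num)]
  rw [h1]
  have h2 : (0 - (-Complex.I * (ξ:ℂ)) ^ 2 / (4 * (-(1/4)))) = ((-ξ ^ 2 : ℝ) : ℂ) := by
    push_cast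
    rw [mul_pow, neg_sq, Complex.I_sq]; ring
  rw [h2]
  push_cast; ring

open Polynomial

lemma derivative_physHermite (n : ℕ) :
    derivative (physHermite n) = C (2 * n : ℝ) * physHermite (n - 1) := by
  induction n with
  | zero => simp [physHermite]
  | succ n ih =>
    have h2 : (2 : ℝ[X]) = C 2 := rfl
    have h3 : C (2 * n : ℝ) * physHermite n = C (2 * n : ℝ) *
        (C 2 * X * physHermite (n - 1) - derivative (physHermite (n - 1))) := by
      cases n with
      | zero => simp
      | succ n => rw [Nat.add_sub_cancel, ← h2, physHermite]
    rw [physHermite, h2, derivative_sub, ih, derivative_C_mul, derivative_mul, derivative_C_mul,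
      derivative_X, ih, Nat.add_sub_cancel]
    have h4 : C (2 * ((n + 1 : ℕ) : ℝ)) = C 2 + C (2 * n : ℝ) := by
      rw [← C_add]; push_cast; ring_nf
    rw [h4]
    linear_combination -h3

/-- Complexified Hermite polynomial. -/
def cH (n : ℕ) : ℂ[X] := (physHermite n).map Complex.ofRealHom

lemma cH_succ (n : ℕ) : cH (n + 1) = 2 * X * cH n - derivative (cH n) := by
  simp [cH, physHermite, Polynomial.derivative_map]

lemma derivative_cH (n : ℕ) : derivative (cH n) = C (2 * n : ℂ) * cH (n - 1) := by
  rw [cH, derivative_map, derivative_physHermite]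
  simp [cH]

/-- `H_m(x + v/2) H_n(x - v/2)` integrated. -/
def gI (x ξ : ℝ) (m n : ℕ) : ℂ :=
  gJ ξ ((cH m).comp (C (x : ℂ) + C (1/2) * X) * (cH n).comp (C (x : ℂ) - C (1/2) * X))

lemma gI_succ_left (x ξ : ℝ) (m n : ℕ) :
    gI x ξ (m + 1) n = 2 * (x - Complex.I * ξ) * gI x ξ m n - 2 * n * gI x ξ m (n - 1) := by
  have h := gJ_ibp ξ ((cH m).comp (C (x : ℂ) + C (1/2) * X) * (cH n).comp (C (x : ℂ) - C (1/2) * X))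
  set P : ℂ[X] := (cH m).comp (C (x : ℂ) + C (1/2) * X) with hP
  set Q : ℂ[X] := (cH n).comp (C (x : ℂ) - C (1/2) * X) with hQ
  set Q' : ℂ[X] := (cH (n - 1)).comp (C (x : ℂ) - C (1/2) * X) with hQ'
  have hdQ : derivative Q = C (-(n : ℂ)) * Q' := by
    rw [hQ, derivative_comp, derivative_cH]
    simp only [derivative_sub, derivative_mul, derivative_C, derivative_X, mul_comp, C_comp, ← hQ']
    simp only [zero_mul, mul_one, zero_add, zero_sub, map_mul, map_neg]
    have : (C (1/2 : ℂ)) * C 2 = 1 := by rw [← C_mul]; norm_num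
    linear_combination (-C (n : ℂ) * Q') * this
  have hdP : derivative P = C (1/2) * (derivative (cH m)).comp (C (x : ℂ) + C (1/2) * X) := by
    rw [hP, derivative_comp]
    simp
  have hS : (cH (m + 1)).comp (C (x : ℂ) + C (1/2) * X) =
      C 2 * (C (x : ℂ) + C (1/2) * X) * P - C 2 * derivative P := by
    have : (C (1/2 : ℂ)) * C 2 = 1 := by rw [← C_mul]; norm_num
    rw [cH_succ, hdP, sub_comp, mul_comp, mul_comp, X_comp, ← hP]
    have h2 : (2 : ℂ[X]).comp (C (x : ℂ) + C (1/2) * X) = C 2 := by simp; rfl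
    rw [h2]
    linear_combination ((derivative (cH m)).comp (C (x : ℂ) + C (1/2) * X)) * this
  have key : (cH (m + 1)).comp (C (x : ℂ) + C (1/2) * X) * Q =
      C (2 * (x - Complex.I * ξ)) * (P * Q) + (C (-(2 * (n : ℂ))) * (P * Q') +
      C (-2) * (derivative (P * Q) - (C (1/2) * X + C (Complex.I * ξ)) * (P * Q))) := by
    rw [hS, derivative_mul, hdQ]
    simp only [map_mul, map_neg, map_sub]
    ring
  unfold gI
  rw [← hP, ← hQ, ← hQ', key, gJ_add, gJ_add, gJ_smul, gJ_smul, gJ_smul, h]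
  ring

lemma gI_zero_succ (x ξ : ℝ) (n : ℕ) :
    gI x ξ 0 (n + 1) = 2 * (x + Complex.I * ξ) * gI x ξ 0 n := by
  have h := gJ_ibp ξ ((cH n).comp (C (x : ℂ) - C (1/2) * X))
  set Q : ℂ[X] := (cH n).comp (C (x : ℂ) - C (1/2) * X) with hQ
  have h12 : (C (1/2 : ℂ)) * C 2 = 1 := by rw [← C_mul]; norm_num
  have hdQ : derivative Q = -C (1/2) * (derivative (cH n)).comp (C (x : ℂ) - C (1/2) * X) := by
    rw [hQ, derivative_comp]
    simp
  have hS : (cH (n + 1)).comp (C (x : ℂ) - C (1/2) * X) =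
      C 2 * (C (x : ℂ) - C (1/2) * X) * Q + C 2 * derivative Q := by
    rw [cH_succ, hdQ, sub_comp, mul_comp, mul_comp, X_comp, ← hQ]
    have h2 : (2 : ℂ[X]).comp (C (x : ℂ) - C (1/2) * X) = C 2 := by simp; rfl
    rw [h2]
    linear_combination ((derivative (cH n)).comp (C (x : ℂ) - C (1/2) * X)) * h12
  have key : (cH (n + 1)).comp (C (x : ℂ) - C (1/2) * X) =
      C (2 * (x + Complex.I * ξ)) * Q +
      C 2 * (derivative Q - (C (1/2) * X + C (Complex.I * ξ)) * Q) := by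
    rw [hS]
    simp only [map_mul, map_add]
    ring
  have h0 : cH 0 = 1 := by simp [cH, physHermite]
  unfold gI
  rw [h0, one_comp, one_mul, one_mul, key, gJ_add, gJ_smul, gJ_smul, h]
  ring

lemma gI_zero (x ξ : ℝ) (n : ℕ) : gI x ξ 0 n = (2 * (x + Complex.I * ξ)) ^ n * gJ ξ 1 := by
  induction n with
  | zero => simp [gI, cH, physHermite]
  | succ n ih => rw [gI_zero_succ, ih]; ring

lemma gI_formula (x ξ : ℝ) (m n : ℕ) : gI x ξ m n =
    ∑ k ∈ Finset.range (m + 1), (m.choose k : ℂ) * (n.descFactorial k) * (-2) ^ k *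
      (2 * (x - Complex.I * ξ)) ^ (m - k) * (2 * (x + Complex.I * ξ)) ^ (n - k) * gJ ξ 1 := by
  induction m generalizing n with
  | zero => simp [gI_zero]
  | succ m ih =>
    rw [gI_succ_left, ih, ih, Finset.sum_range_succ' _ (m + 1)]
    set a := (2 * (x - Complex.I * ξ))
    set b := (2 * (x + Complex.I * ξ))
    have e1 : ∀ k ∈ Finset.range (m + 1), (((m + 1).choose (k + 1) : ℕ) : ℂ) *
        (n.descFactorial (k + 1)) * (-2) ^ (k + 1) * a ^ (m + 1 - (k + 1)) * b ^ (n - (k + 1)) *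
          gJ ξ 1 = (m.choose (k + 1) : ℂ) *
        (n.descFactorial (k + 1)) * (-2) ^ (k + 1) * a ^ (m - k) * b ^ (n - (k + 1)) * gJ ξ 1 -
        2 * n * ((m.choose k : ℂ) * ((n - 1).descFactorial k) * (-2) ^ k *
      a ^ (m - k) * b ^ (n - 1 - k) * gJ ξ 1) := by
      intro k _
      rw [Nat.choose_succ_succ, Nat.add_sub_add_right]
      have hd : ((n.descFactorial (k + 1) : ℕ) : ℂ) = n * ((n - 1).descFactorial k) := by
        cases n with
        | zero => simp
        | succ n => rw [Nat.succ_descFactorial_succ]; push_cast; simp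
      rw [hd, show n - (k + 1) = n - 1 - k by omega]
      push_cast
      ring
    rw [Finset.sum_congr rfl e1, Finset.sum_sub_distrib, ← Finset.mul_sum]
    have e2 : a * ∑ k ∈ Finset.range (m + 1), (m.choose k : ℂ) * (n.descFactorial k) * (-2) ^ k *
      a ^ (m - k) * b ^ (n - k) * gJ ξ 1 = ∑ k ∈ Finset.range (m + 1), (m.choose (k + 1) : ℂ) *
        (n.descFactorial (k + 1)) * (-2) ^ (k + 1) * a ^ (m - k) * b ^ (n - (k + 1)) * gJ ξ 1
        + a ^ (m + 1) * b ^ n * gJ ξ 1 := by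
      rw [Finset.sum_range_succ', Finset.sum_range_succ (n := m), mul_add, Finset.mul_sum]
      congr 1
      · rw [Nat.choose_succ_self]
        simp only [Nat.cast_zero, zero_mul, add_zero]
        refine Finset.sum_congr rfl fun k hk => ?_
        have : m - k = m - (k + 1) + 1 := by have := Finset.mem_range.1 hk; omega
        rw [this, pow_succ]
        ring
      · simp; ring
    rw [e2]
    simp
    ring

lemma gI_diag (x ξ : ℝ) (n : ℕ) : gI x ξ n n =
    ((2 ^ n * n.factorial * (-1) ^ n * assocLaguerre n 0 (2 * (x ^ 2 + ξ ^ 2)) : ℝ) : ℂ) *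
      gJ ξ 1 := by
  rw [gI_formula, ← Finset.sum_mul]
  congr 1
  rw [assocLaguerre, Finset.mul_sum, ← Finset.sum_range_reflect]
  push_cast
  refine Finset.sum_congr rfl fun j hj => ?_
  have hj' : j ≤ n := by simpa [Nat.lt_succ_iff] using hj
  obtain ⟨k, rfl⟩ := Nat.exists_eq_add_of_le hj'
  have s2 : j + k - k = j := by omega
  have s3 : j + k - j = k := by omega
  rw [s3, s2, mul_assoc _ ((2 * ((x:ℂ) - Complex.I * ξ)) ^ j), ← mul_pow]
  have hz : (2 * ((x:ℂ) - Complex.I * ξ) * (2 * (x + Complex.I * ξ))) =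
      2 * (2 * (x ^ 2 + ξ ^ 2)) := by
    linear_combination (-4 * (ξ : ℂ) ^ 2) * Complex.I_sq
  rw [hz]
  have hd : (((j + k).descFactorial k : ℕ) : ℂ) = (j + k).factorial / j.factorial := by
    rw [Nat.descFactorial_eq_div (by omega), s2, Nat.cast_div (Nat.factorial_dvd_factorial (by omega)) 
      (by exact_mod_cast Nat.factorial_ne_zero j)]
  rw [hd, neg_pow, mul_pow 2 (2 * ((x:ℂ) ^ 2 + ξ ^ 2)), pow_add, pow_add, add_zero]
  have : ((-1 : ℂ) ^ j) * (-1) ^ j = 1 := by rw [← mul_pow]; simp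
  linear_combination (-((j + k).choose k : ℂ) * ((j + k).factorial / j.factorial) * (-1) ^ k * 2 ^ k
    * 2 ^ j * (2 * ((x:ℂ) ^ 2 + ξ ^ 2)) ^ j) * this

/-- Geometric series. -/
def geomU : PowerSeries ℝ := PowerSeries.mk 1

lemma hasSubst_XU : PowerSeries.HasSubst (PowerSeries.X * geomU : PowerSeries ℝ) :=
  PowerSeries.HasSubst.of_constantCoeff_zero' (by simp)

/-- Laguerre generating function factor. -/
def lagE (x : ℝ) : PowerSeries ℝ :=
  (PowerSeries.rescale (-x) (PowerSeries.exp ℝ)).subst (PowerSeries.X * geomU : PowerSeries ℝ)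

lemma lagE_add (x y : ℝ) : lagE (x + y) = lagE x * lagE y := by
  unfold lagE
  rw [← PowerSeries.subst_mul hasSubst_XU, PowerSeries.exp_mul_exp_eq_exp_add]
  congr 2; ring_nf

lemma lagE_zero : lagE 0 = 1 := by
  unfold lagE
  have : (PowerSeries.rescale (-(0:ℝ)) (PowerSeries.exp ℝ)) = 1 := by
    simp
  rw [this, ← PowerSeries.coe_substAlgHom hasSubst_XU, map_one]

lemma lagE_sum {d : ℕ} (y : Fin d → ℝ) : lagE (∑ j, y j) = ∏ j, lagE (y j) := by
  induction d with
  | zero => simp [lagE_zero]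
  | succ d ih => rw [Fin.sum_univ_succ, Fin.prod_univ_succ, lagE_add, ih]

lemma coeff_geom (N a j : ℕ) (hj : j ≤ N) :
    PowerSeries.coeff N (geomU ^ (a + 1) * (PowerSeries.X * geomU) ^ j) =
      ((N + a).choose (N - j) : ℝ) := by
  have : geomU ^ (a + 1) * (PowerSeries.X * geomU) ^ j =
      PowerSeries.X ^ j * geomU ^ (a + j + 1) := by ring
  rw [this, PowerSeries.coeff_X_pow_mul', if_pos hj]
  unfold geomU
  rw [PowerSeries.mk_one_pow_eq_mk_choose_add, PowerSeries.coeff_mk]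
  norm_cast
  rw [← Nat.choose_symm_of_eq_add (n := N + a) (a := a + j) (b := N - j) (by omega)]
  congr 1
  omega

lemma coeff_lag (N a : ℕ) (x : ℝ) :
    PowerSeries.coeff N (geomU ^ (a + 1) * lagE x) = assocLaguerre N a x := by
  unfold lagE
  rw [PowerSeries.eq_X_pow_mul_shift_add_trunc (N + 1)
    (PowerSeries.rescale (-x) (PowerSeries.exp ℝ)),
    PowerSeries.subst_add hasSubst_XU, PowerSeries.subst_mul hasSubst_XU,
    PowerSeries.subst_pow hasSubst_XU, PowerSeries.subst_X hasSubst_XU,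
    PowerSeries.subst_coe hasSubst_XU, mul_add, map_add]
  have h0 : ∀ g : PowerSeries ℝ, PowerSeries.coeff N
      (geomU ^ (a + 1) * ((PowerSeries.X * geomU) ^ (N + 1) * g)) = 0 := by
    intro g
    have : geomU ^ (a + 1) * ((PowerSeries.X * geomU) ^ (N + 1) * g) =
      PowerSeries.X ^ (N + 1) * (geomU ^ (a + 1) * geomU ^ (N + 1) * g) := by ring
    rw [this, PowerSeries.coeff_X_pow_mul', if_neg (by omega)]
  rw [h0, zero_add]
  have ht : PowerSeries.trunc (N + 1) (PowerSeries.rescale (-x) (PowerSeries.exp ℝ)) =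
      ∑ j ∈ Finset.range (N + 1), Polynomial.monomial j
        (PowerSeries.coeff j (PowerSeries.rescale (-x) (PowerSeries.exp ℝ))) := by
    ext j
    simp [PowerSeries.coeff_trunc, Polynomial.finsetSum_coeff, Polynomial.coeff_monomial]
  rw [ht, map_sum, Finset.mul_sum, map_sum, assocLaguerre]
  simp only [Polynomial.aeval_monomial]
  refine Finset.sum_congr rfl fun j hj => ?_
  have hj' : j ≤ N := by simpa [Nat.lt_succ_iff] using hj
  rw [mul_left_comm, PowerSeries.algebraMap_apply, PowerSeries.coeff_C_mul, coeff_geom _ _ _ hj']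
  simp [PowerSeries.coeff_rescale, PowerSeries.coeff_exp, neg_pow x]
  ring

lemma lag_add (d N : ℕ) (hd : 1 ≤ d) (y : Fin d → ℝ) :
    ∑ α ∈ Finset.Nat.antidiagonalTuple d N, ∏ j, assocLaguerre (α j) 0 (y j) =
      assocLaguerre N (d - 1) (∑ j, y j) := by
  rw [← coeff_lag, lagE_sum, show d - 1 + 1 = d by omega]
  have : geomU ^ d * ∏ j, lagE (y j) = ∏ j, (geomU ^ (0 + 1) * lagE (y j)) := by
    rw [Finset.prod_mul_distrib]; simp
  rw [this, PowerSeries.coeff_prod]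
  symm
  refine Finset.sum_bij (fun l _ => ⇑l) ?_ ?_ ?_ ?_
  · intro l hl
    simpa [Finset.Nat.mem_antidiagonalTuple] using hl
  · intro l _ l' _ h
    exact DFunLike.coe_injective h
  · intro b hb
    refine ⟨Finsupp.equivFunOnFinite.symm b, ?_, ?_⟩
    · simpa [Finset.Nat.mem_antidiagonalTuple] using hb
    · ext; simp
  · intro l _
    simp only [coeff_lag]

/-- One-dimensional Wigner integrand. -/
def wf (n : ℕ) (x ξ u : ℝ) : ℂ :=
  ((hermiteFun n (x + u / 2) * hermiteFun n (x - u / 2) : ℝ) : ℂ) *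
    Complex.exp (-Complex.I * (u * ξ : ℝ))

lemma norm_const (n : ℕ) : ((2 : ℝ) ^ n * (n.factorial : ℝ) * Real.sqrt π) ^ (-(1 : ℝ) / 2) *
    ((2 : ℝ) ^ n * (n.factorial : ℝ) * Real.sqrt π) ^ (-(1 : ℝ) / 2) =
      ((2 : ℝ) ^ n * (n.factorial : ℝ) * Real.sqrt π)⁻¹ := by
  have : 0 < (2 : ℝ) ^ n * (n.factorial : ℝ) * Real.sqrt π := by
    have := Real.pi_pos
    have := n.factorial_pos
    positivity
  rw [← Real.rpow_add this, ← Real.rpow_neg_one]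
  norm_num

lemma eval_cH (n : ℕ) (t : ℝ) : (cH n).eval (t : ℂ) = (((physHermite n).eval t : ℝ) : ℂ) := by
  rw [cH, Polynomial.eval_map]
  exact Polynomial.eval₂_at_apply Complex.ofRealHom t

lemma wf_eq (n : ℕ) (x ξ u : ℝ) : wf n x ξ u =
    ((((2 : ℝ) ^ n * (n.factorial : ℝ) * Real.sqrt π)⁻¹ * Real.exp (-x ^ 2) : ℝ) : ℂ) *
    ((((cH n).comp (C (x : ℂ) + C (1/2) * X) *
      (cH n).comp (C (x : ℂ) - C (1/2) * X))).eval (u : ℂ) *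
        Complex.exp (-(1/4) * (u : ℂ) ^ 2 + (-Complex.I * ξ) * u + 0)) := by
  rw [Polynomial.eval_mul, Polynomial.eval_comp, Polynomial.eval_comp]
  have e1 : (C (x : ℂ) + C (1/2) * X).eval (u : ℂ) = ((x + u / 2 : ℝ) : ℂ) := by
    simp; ring
  have e2 : (C (x : ℂ) - C (1/2) * X).eval (u : ℂ) = ((x - u / 2 : ℝ) : ℂ) := by
    simp; ring
  rw [e1, e2, eval_cH, eval_cH, wf, hermiteFun, hermiteFun, ← norm_const]
  have e3 : Complex.exp (-(1/4) * (u : ℂ) ^ 2 + (-Complex.I * ξ) * u + 0) =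
      (Real.exp (-(1/4) * u ^ 2) : ℝ) * Complex.exp (-Complex.I * (u * ξ : ℝ)) := by
    rw [Complex.ofReal_exp, ← Complex.exp_add]
    push_cast; ring_nf
  rw [e3]
  have e4 : Real.exp (-(x + u / 2) ^ 2 / 2) * Real.exp (-(x - u / 2) ^ 2 / 2) =
      Real.exp (-x ^ 2) * Real.exp (-(1/4) * u ^ 2) := by
    rw [← Real.exp_add, ← Real.exp_add]; ring_nf
  have e5 := congrArg (fun r : ℝ => (r : ℂ)) e4
  simp only [Complex.ofReal_mul] at e5 ⊢
  linear_combination (((((2 : ℝ) ^ n * (n.factorial : ℝ) * Real.sqrt π) ^ (-(1 : ℝ) / 2) : ℝ) : ℂ) *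
    ((((2 : ℝ) ^ n * (n.factorial : ℝ) * Real.sqrt π) ^ (-(1 : ℝ) / 2) : ℝ) : ℂ) *
    (((physHermite n).eval (x + u / 2) : ℝ) : ℂ) * (((physHermite n).eval (x - u / 2) : ℝ) : ℂ) *
    Complex.exp (-Complex.I * ((u : ℂ) * ξ))) * e5

lemma wf_integrable (n : ℕ) (x ξ : ℝ) : Integrable (wf n x ξ) := by
  have : wf n x ξ = fun u => _ := funext fun u => wf_eq n x ξ u
  rw [this]
  exact (gJ_integrable ξ _).const_mul _

lemma wf_integral (n : ℕ) (x ξ : ℝ) : ∫ u, wf n x ξ u =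
    ((2 * (-1) ^ n * Real.exp (-(x ^ 2 + ξ ^ 2)) * assocLaguerre n 0 (2 * (x ^ 2 + ξ ^ 2)) : ℝ) : ℂ) := by
  simp only [wf_eq]
  rw [integral_const_mul]
  have := gI_diag x ξ n
  rw [gI, gJ_one] at this
  rw [gJ] at this
  rw [this]
  have h2 : ((2 : ℝ)) * (Real.sqrt π * Real.exp (-ξ ^ 2)) = 2 * (Real.sqrt π * Real.exp (-ξ ^ 2)) := rfl
  rw [show (2 : ℂ) = ((2 : ℝ) : ℂ) by norm_num, ← Complex.ofReal_mul, ← Complex.ofReal_mul,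
    ← Complex.ofReal_mul]
  congr 1
  have hs : Real.sqrt π ≠ 0 := (Real.sqrt_pos.2 Real.pi_pos).ne'
  have hf : (n.factorial : ℝ) ≠ 0 := by exact_mod_cast n.factorial_ne_zero
  rw [neg_add, Real.exp_add]
  field_simp

lemma wf_scaled_integral (n : ℕ) (s : ℝ) (hs : 0 < s) (x ξ : ℝ) : ∫ v, wf n x ξ (s * v) =
    ((s⁻¹ * (2 * (-1) ^ n * Real.exp (-(x ^ 2 + ξ ^ 2)) * assocLaguerre n 0 (2 * (x ^ 2 + ξ ^ 2))) : ℝ) : ℂ) := by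
  rw [Measure.integral_comp_mul_left (fun v => wf n x ξ v), wf_integral, abs_of_pos (by positivity)]
  rw [Complex.real_smul, ← Complex.ofReal_mul]

lemma integrand_eq (d : ℕ) (N : ℕ) (hb : ℝ) (hhb : 0 < hb) (x ξ v : Fin d → ℝ) :
      ((projKer d hb N (fun j => x j + v j / 2) (fun j => x j - v j / 2) : ℝ) : ℂ) *
        Complex.exp (-Complex.I * (dotR v ξ : ℂ) / (hb : ℂ)) =
    ∑ α ∈ Finset.Nat.antidiagonalTuple d N, ((((hb ^ (-(1 : ℝ) / 2)) ^ d : ℝ) : ℂ) *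
      ∏ j, wf (α j) (hb ^ (-(1 : ℝ) / 2) * x j) (hb ^ (-(1 : ℝ) / 2) * ξ j)
        (hb ^ (-(1 : ℝ) / 2) * v j)) := by
  have hs2 : hb ^ (-(1 : ℝ) / 2) * hb ^ (-(1 : ℝ) / 2) = hb⁻¹ := by
    rw [← Real.rpow_add hhb, ← Real.rpow_neg_one]; norm_num
  have hd2 : hb ^ (-(d : ℝ) / 4) * hb ^ (-(d : ℝ) / 4) = (hb ^ (-(1 : ℝ) / 2)) ^ d := by
    rw [← Real.rpow_add hhb, ← Real.rpow_natCast, ← Real.rpow_mul hhb.le]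
    congr 1; ring
  rw [projKer, Complex.ofReal_sum, Finset.sum_mul]
  refine Finset.sum_congr rfl fun α _ => ?_
  have hexp : Complex.exp (-Complex.I * (dotR v ξ : ℂ) / (hb : ℂ)) =
      ∏ j, Complex.exp (-Complex.I *
        (((hb ^ (-(1 : ℝ) / 2) * v j) * (hb ^ (-(1 : ℝ) / 2) * ξ j) : ℝ) : ℂ)) := by
    rw [← Complex.exp_sum, ← Finset.mul_sum, ← Complex.ofReal_sum, mul_div_assoc,
      ← Complex.ofReal_div]
    congr 3
    rw [dotR, div_eq_mul_inv, ← hs2, Finset.sum_mul]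
    exact Finset.sum_congr rfl fun j _ => by ring
  rw [hexp, ← hd2]
  simp only [wf, hermiteProdH, hermiteProd, Finset.prod_mul_distrib]
  have ea : ∀ j, hb ^ (-(1 : ℝ) / 2) * x j + hb ^ (-(1 : ℝ) / 2) * v j / 2 =
    hb ^ (-(1 : ℝ) / 2) * (x j + v j / 2) := fun j => by ring
  have eb : ∀ j, hb ^ (-(1 : ℝ) / 2) * x j - hb ^ (-(1 : ℝ) / 2) * v j / 2 =
    hb ^ (-(1 : ℝ) / 2) * (x j - v j / 2) := fun j => by ring
  simp only [ea, eb, Complex.ofReal_mul, Complex.ofReal_prod, Finset.prod_mul_distrib]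
  ring

/-- The Wigner distribution of the `N`-th eigenspace projection of the isotropic harmonic
oscillator equals `((-1)^N/(πħ)^d) e^{-2H/ħ} L_N^{(d-1)}(4H/ħ)`. -/
theorem wigner_eq_laguerre (d : ℕ) (hd : 1 ≤ d) (N : ℕ) (hb : ℝ) (hhb : 0 < hb)
    (x ξ : Fin d → ℝ) :
    wigner d hb N x ξ =
      (((-1 : ℝ) ^ N / (π * hb) ^ d * Real.exp (-2 * Hfun x ξ / hb) *
        assocLaguerre N (d - 1) (4 * Hfun x ξ / hb) : ℝ) : ℂ) := by
  set s : ℝ := hb ^ (-(1 : ℝ) / 2) with hs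
  have hs0 : 0 < s := Real.rpow_pos_of_pos hhb _
  have hs2 : s ^ 2 = hb⁻¹ := by
    rw [pow_two, hs, ← Real.rpow_add hhb, ← Real.rpow_neg_one]; norm_num
  rw [wigner]
  simp only [integrand_eq d N hb hhb x ξ, ← hs]
  rw [integral_finsetSum]
  swap
  · intro α _
    refine Integrable.const_mul ?_ _
    exact Integrable.fintype_prod (f := fun j v => wf (α j) (s * x j) (s * ξ j) (s * v))
      (fun j => (wf_integrable (α j) (s * x j) (s * ξ j)).comp_mul_left' hs0.ne')
  have hterm : ∀ α ∈ Finset.Nat.antidiagonalTuple d N,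
      (∫ v : Fin d → ℝ, ((s ^ d : ℝ) : ℂ) * ∏ j, wf (α j) (s * x j) (s * ξ j) (s * v j)) =
      ((2 ^ d * (-1) ^ N * Real.exp (-2 * Hfun x ξ / hb) *
        ∏ j, assocLaguerre (α j) 0 (2 * ((s * x j) ^ 2 + (s * ξ j) ^ 2)) : ℝ) : ℂ) := by
    intro α hα
    rw [integral_const_mul, integral_fintype_prod_volume_eq_prod
      (f := fun j v => wf (α j) (s * x j) (s * ξ j) (s * v))]
    simp only [wf_scaled_integral _ s hs0]
    rw [← Complex.ofReal_prod, ← Complex.ofReal_mul]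
    congr 1
    simp only [Finset.prod_mul_distrib, Finset.prod_const, Finset.card_univ, Fintype.card_fin,
      Finset.prod_pow_eq_pow_sum, (Finset.Nat.mem_antidiagonalTuple.1 hα), ← Real.exp_sum]
    have he : ∑ j, -((s * x j) ^ 2 + (s * ξ j) ^ 2) = -2 * Hfun x ξ / hb := by
      rw [Hfun, div_eq_mul_inv, ← hs2, ← Finset.sum_add_distrib, Finset.sum_div, Finset.mul_sum,
        Finset.sum_mul]
      exact Finset.sum_congr rfl fun j _ => by ring
    rw [he]
    have : s ^ d * s⁻¹ ^ d = 1 := by rw [← mul_pow, mul_inv_cancel₀ hs0.ne', one_pow]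
    linear_combination (2 ^ d * (-1) ^ N * Real.exp (-2 * Hfun x ξ / hb) *
        ∏ j, assocLaguerre (α j) 0 (2 * ((s * x j) ^ 2 + (s * ξ j) ^ 2))) * this
  rw [Finset.sum_congr rfl hterm, ← Complex.ofReal_sum, ← Complex.ofReal_mul, ← Finset.mul_sum,
    lag_add d N hd]
  congr 1
  have hH : ∑ j, 2 * ((s * x j) ^ 2 + (s * ξ j) ^ 2) = 4 * Hfun x ξ / hb := by
    rw [Hfun, div_eq_mul_inv, ← hs2, ← Finset.sum_add_distrib, Finset.sum_div, Finset.mul_sum,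
      Finset.sum_mul]
    exact Finset.sum_congr rfl fun j _ => by ring
  rw [hH, mul_assoc 2 π hb, mul_pow 2 (π * hb)]
  have : (π * hb) ^ d ≠ 0 := by have := Real.pi_pos; positivity
  field_simp
end
end
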